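/- For every circuit C⃗_n of order n = 2km + x, with k, m ≥ 1, 0 ≤ x < 2k, and (x, n) ∉ {(1,4), (1,6)}, the k-labeled packing number satisfies λ^k(C⃗_n) = ⌊n/2⌋ + ⌊⌈n/2⌉ / k⌋. -/

import Mathlib

/-- The arc set of the circuit (directed cycle) `C⃗_n`, whose vertex set is `ZMod n`
and whose arcs go from each vertex `v` to `v + 1`. -/
def circuitArcs (n : ℕ) : Set (ZMod n × ZMod n) :=
  {a | ∃ v : ZMod n, a = (v, v + 1)}

/-- The `k` bijections `σ 1, …, σ k` from the vertices of `C⃗_n` to the vertices of the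
complete digraph `↔K_n` form a `k`-placement of `C⃗_n`: the images of the arcs of `C⃗_n`
are arcs of `↔K_n` (they join distinct vertices), and the images of the arc set of
`C⃗_n` under the `σ i` are pairwise disjoint. -/
def IsDirPlacement (n k : ℕ) (σ : Fin k → (ZMod n ≃ ZMod n)) : Prop :=
  (∀ i : Fin k, ∀ a ∈ circuitArcs n, σ i a.1 ≠ σ i a.2) ∧
  (∀ i j : Fin k, i ≠ j →
    Disjoint ((fun a => (σ i a.1, σ i a.2)) '' circuitArcs n)
      ((fun a => (σ j a.1, σ j a.2)) '' circuitArcs n))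

/-- `f`, a labeling of the `n` vertices of `↔K_n` using exactly `p` distinct labels
(i.e. a surjection onto `Fin p`), together with `k` bijections `σ 1, …, σ k`, is a
`p`-labeled packing of `k` copies of `C⃗_n` into `↔K_n`: the `σ i` form a `k`-placement
of `C⃗_n` and, for every vertex `v` of `C⃗_n`, all the images `σ i v` carry the same
label. -/
def IsDirLabeledPacking (n k p : ℕ) (f : ZMod n → Fin p)
    (σ : Fin k → (ZMod n ≃ ZMod n)) : Prop :=
  Function.Surjective f ∧ IsDirPlacement n k σ ∧
  (∀ i j : Fin k, ∀ v : ZMod n, f (σ i v) = f (σ j v))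

/-- The `k`-labeled packing number `λ^k(C⃗_n)`: the largest `p` such that there is a
`p`-labeled packing of `k` copies of `C⃗_n` into `↔K_n`. -/
noncomputable def dirLabeledPackingNumber (n k : ℕ) : ℕ :=
  sSup {p | ∃ f σ, IsDirLabeledPacking n k p f σ}

/-- The number of vertices sharing the label of `v`. -/
def labelClassCard {α β : Type*} [Fintype α] [DecidableEq β] (g : α → β) (v : α) : ℕ :=
  (Finset.univ.filter fun u => g u = g v).card

lemma labelClassCard_pos {α β : Type*} [Fintype α] [DecidableEq β] (g : α → β) (v : α) :
    0 < labelClassCard g v :=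
  Finset.card_pos.mpr ⟨v, by simp⟩

lemma sum_inv_labelClassCard {α β : Type*} [Fintype α] [Fintype β] [DecidableEq β] (g : α → β)
    (hg : Function.Surjective g) :
    ∑ v, (1 : ℚ) / labelClassCard g v = Fintype.card β := by
  rw [← Finset.sum_fiberwise (s := Finset.univ) (g := g)]
  have h : ∀ b : β, ∑ v with g v = b, (1 : ℚ) / labelClassCard g v = 1 := by
    intro b
    obtain ⟨a, rfl⟩ := hg b
    have hpos : (labelClassCard g a : ℚ) ≠ 0 := by
      exact_mod_cast (labelClassCard_pos g a).ne'
    rw [Finset.sum_congr rfl (g := fun _ => (1 : ℚ) / labelClassCard g a)]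
    · rw [Finset.sum_const, nsmul_eq_mul]
      exact mul_one_div_cancel hpos
    · intro v hv
      rw [Finset.mem_filter] at hv
      simp only [labelClassCard, hv.2]
  rw [Finset.sum_congr rfl fun b _ => h b]
  simp

lemma sum_range_two_mul_le {a : ℕ → ℚ} {c : ℚ} (h : ∀ i, a i + a (i + 1) ≤ c) (m : ℕ) :
    ∑ i ∈ Finset.range (2 * m), a i ≤ m * c := by
  induction m with
  | zero => simp
  | succ m ih =>
    rw [show 2 * (m + 1) = 2 * m + 1 + 1 by ring, Finset.sum_range_succ, Finset.sum_range_succ]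
    have := h (2 * m)
    push_cast
    linarith

lemma ZMod.sum_eq_sum_range_add {n : ℕ} [NeZero n] (w : ZMod n → ℚ) (c : ZMod n) :
    ∑ v, w v = ∑ i ∈ Finset.range n, w (c + i) := by
  rw [← Equiv.sum_comp (Equiv.addLeft c)]
  refine Finset.sum_bij' (fun v _ => v.val) (fun i _ => (i : ZMod n)) ?_ ?_ ?_ ?_ ?_
  · intro v _
    simpa using ZMod.val_lt v
  · simp
  · simp
  · intro i hi
    exact ZMod.val_cast_of_lt (Finset.mem_range.mp hi)
  · simp

lemma one_div_add_one_div_le {k s t : ℕ} (hk : 1 ≤ k) (hs : 1 ≤ s) (ht : 1 ≤ t)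
    (h : k ≤ s * t) : (1 : ℚ) / s + 1 / t ≤ 1 + 1 / k := by
  have hk' : (0 : ℚ) < k := by exact_mod_cast hk
  have hs' : (1 : ℚ) / s ≤ 1 := by
    rw [div_le_one (by exact_mod_cast hs)]
    exact_mod_cast hs
  have ht' : (1 : ℚ) / t ≤ 1 := by
    rw [div_le_one (by exact_mod_cast ht)]
    exact_mod_cast ht
  have hst : (1 : ℚ) / s * (1 / t) ≤ 1 / k := by
    rw [one_div_mul_one_div]
    exact one_div_le_one_div_of_le hk' (by exact_mod_cast h)
  nlinarith [mul_nonneg (sub_nonneg.mpr hs') (sub_nonneg.mpr ht')]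

/-- If consecutive vertices of a circuit have label classes of product at least `k`, then the
number of labels is at most `⌊n/2⌋ + ⌊⌈n/2⌉/k⌋`. -/
lemma card_labels_le {n k p : ℕ} [NeZero n] (hk : 1 ≤ k) (g : ZMod n → Fin p)
    (hg : Function.Surjective g)
    (hmul : ∀ v, k ≤ labelClassCard g v * labelClassCard g (v + 1)) :
    p ≤ n / 2 + (n + 1) / 2 / k := by
  have hk' : (0 : ℚ) < k := by exact_mod_cast hk
  set w : ZMod n → ℚ := fun v => 1 / labelClassCard g v
  have hsum : ∑ v, w v = p := by
    rw [sum_inv_labelClassCard g hg, Fintype.card_fin]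
  have hpair (c : ZMod n) (i : ℕ) : w (c + i) + w (c + (i + 1 : ℕ)) ≤ 1 + 1 / k := by
    have := hmul (c + i)
    rw [add_assoc] at this
    push_cast
    exact one_div_add_one_div_le hk (labelClassCard_pos g _) (labelClassCard_pos g _) this
  have hfinish (c : ℕ) (h : (p : ℚ) ≤ (n / 2 : ℕ) + (c : ℚ) / k) : p ≤ n / 2 + c / k := by
    have h2 : (p : ℚ) * k ≤ (n / 2 : ℕ) * k + c := by
      have := mul_le_mul_of_nonneg_right h hk'.le
      rwa [add_mul, div_mul_cancel₀ _ hk'.ne'] at this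
    have h3 : p * k ≤ n / 2 * k + c := by exact_mod_cast h2
    rw [add_comm, ← Nat.add_mul_div_right _ _ hk, Nat.le_div_iff_mul_le hk]
    omega
  rcases Nat.even_or_odd' n with ⟨h, hn | hn⟩
  · apply hfinish
    have := sum_range_two_mul_le (hpair 0) h
    rw [← hn, ← ZMod.sum_eq_sum_range_add, hsum] at this
    rw [show n / 2 = h by omega, show (n + 1) / 2 = h by omega]
    calc (p : ℚ) ≤ h * (1 + 1 / k) := this
      _ = h + h / k := by ring
  · by_cases hbig : ∃ v, k ≤ labelClassCard g v
    · obtain ⟨v, hv⟩ := hbig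
      apply hfinish
      have h1 := ZMod.sum_eq_sum_range_add w (v + 1)
      have h2 := sum_range_two_mul_le (hpair (v + 1)) h
      have h3 : v + 1 + ((2 * h : ℕ) : ZMod n) = v := by
        have : ((2 * h + 1 : ℕ) : ZMod n) = 0 := by rw [← hn]; exact ZMod.natCast_self n
        push_cast at this ⊢
        linear_combination this
      have h4 : w v ≤ 1 / k := one_div_le_one_div_of_le hk' (by exact_mod_cast hv)
      rw [hsum, show Finset.range n = Finset.range (2 * h + 1) by rw [← hn],
        Finset.sum_range_succ, h3] at h1
      rw [show n / 2 = h by omega, show (n + 1) / 2 = h + 1 by omega]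
      calc (p : ℚ) ≤ h * (1 + 1 / k) + 1 / k := by linarith
        _ = h + ((h + 1 : ℕ) : ℚ) / k := by push_cast; ring
    · push Not at hbig
      have hhalf (v : ZMod n) : w v ≤ 1 / 2 := by
        have h2 : 2 ≤ labelClassCard g v := by
          by_contra hlt
          have h1 : labelClassCard g v = 1 := by
            have := labelClassCard_pos g v
            omega
          have := hmul v
          rw [h1, one_mul] at this
          exact absurd this (hbig _).not_ge
        exact one_div_le_one_div_of_le two_pos (by exact_mod_cast h2)
      have h1 : (p : ℚ) ≤ n * (1 / 2) := by
        rw [← hsum]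
        simpa using Finset.sum_le_sum fun v (_ : v ∈ Finset.univ) => hhalf v
      have h2 : p * 2 ≤ n := by
        have : (p : ℚ) * 2 ≤ n := by linarith
        exact_mod_cast this
      exact Nat.le_add_right_of_le (by omega)

lemma IsDirLabeledPacking.card_le {n k p : ℕ} [NeZero n] (hk : 1 ≤ k) {f : ZMod n → Fin p}
    {σ : Fin k → (ZMod n ≃ ZMod n)} (h : IsDirLabeledPacking n k p f σ) :
    p ≤ n / 2 + (n + 1) / 2 / k := by
  obtain ⟨hf, ⟨-, hdisj⟩, hlab⟩ := h
  let o : Fin k := ⟨0, hk⟩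
  refine card_labels_le hk (f ∘ σ o) (hf.comp (σ o).surjective) fun v => ?_
  rw [labelClassCard, labelClassCard, ← Finset.card_product]
  conv_lhs => rw [← Fintype.card_fin k]
  refine Finset.card_le_card_of_injOn
    (fun i => ((σ o).symm (σ i v), (σ o).symm (σ i (v + 1)))) ?_ ?_
  · intro i _
    simp [hlab i o]
  · intro i _ j _ hij
    by_contra hne
    simp only [Prod.mk.injEq, EmbeddingLike.apply_eq_iff_eq] at hij
    refine Set.disjoint_left.mp (hdisj i j hne) ⟨(v, v + 1), ⟨v, rfl⟩, rfl⟩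
      ⟨(v, v + 1), ⟨v, rfl⟩, ?_⟩
    simp [hij]

lemma exists_perm_family (α : Type*) [Fintype α] (k : ℕ) :
    ∃ τ : Fin k → Equiv.Perm α,
      k ≤ Fintype.card α → ∀ a, Function.Injective fun i => τ i a := by
  by_cases h : k ≤ Fintype.card α
  · rcases isEmpty_or_nonempty α with _ | _
    · exact ⟨fun _ => Equiv.refl α, fun _ a => isEmptyElim a⟩
    · have : NeZero (Fintype.card α) := ⟨Fintype.card_ne_zero⟩
      let e := Fintype.equivFin α
      refine ⟨fun i => (e.trans (Equiv.addLeft (Fin.castLE h i))).trans e.symm,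
        fun _ a i j hij => ?_⟩
      simpa using hij
  · exact ⟨fun _ => Equiv.refl α, fun h' => absurd h' h⟩

/-- There are `k` permutations preserving `g` whose images of any given point in a fiber of size
at least `k` are distinct. -/
lemma exists_fiberwise_perm_family {α β : Type*} [Fintype α] [DecidableEq β] (g : α → β)
    (k : ℕ) :
    ∃ τ : Fin k → Equiv.Perm α, (∀ i a, g (τ i a) = g a) ∧
      ∀ a, k ≤ Fintype.card {x // g x = g a} → Function.Injective fun i => τ i a := by
  choose τ hτ using fun b : β => exists_perm_family {x // g x = b} k
  let e := Equiv.sigmaFiberEquiv g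
  have happ (i : Fin k) (a : α) : (e.symm.trans
      ((Equiv.sigmaCongrRight fun b => τ b i).trans e)) a = τ (g a) i ⟨a, rfl⟩ := rfl
  refine ⟨fun i => e.symm.trans ((Equiv.sigmaCongrRight fun b => τ b i).trans e), ?_, ?_⟩
  · intro i a
    rw [happ]
    exact (τ (g a) i ⟨a, rfl⟩).2
  · intro a ha i j hij
    simp only [happ] at hij
    exact hτ (g a) ha ⟨a, rfl⟩ (Subtype.ext hij)

lemma ZMod.val_add_one_eq_ite {n : ℕ} (hn : 2 ≤ n) (u : ZMod n) :
    (u + 1).val = if u.val + 1 = n then 0 else u.val + 1 := by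
  have : NeZero n := ⟨by omega⟩
  have : Fact (1 < n) := ⟨hn⟩
  have hlt := ZMod.val_lt u
  rw [ZMod.val_add, ZMod.val_one]
  split_ifs with h
  · simp [h]
  · exact Nat.mod_eq_of_lt (by omega)

/-- Vertices of odd value get distinct labels below `n / 2`; those of even value get `q` further
labels, periodically. -/
def alternatingLabel (n q : ℕ) (v : ZMod n) : ℕ :=
  if v.val % 2 = 1 then v.val / 2 else n / 2 + v.val / 2 % q

lemma alternatingLabel_lt_half_iff {n : ℕ} [NeZero n] (q : ℕ) (v : ZMod n) :
    alternatingLabel n q v < n / 2 ↔ v.val % 2 = 1 := by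
  have := ZMod.val_lt v
  unfold alternatingLabel
  split_ifs with h <;> omega

lemma eq_of_alternatingLabel_eq {n q : ℕ} [NeZero n] {u v : ZMod n} (hu : u.val % 2 = 1)
    (h : alternatingLabel n q u = alternatingLabel n q v) : u = v := by
  have hv : v.val % 2 = 1 := by
    rwa [← alternatingLabel_lt_half_iff q, ← h, alternatingLabel_lt_half_iff]
  simp only [alternatingLabel, hu, hv, if_true] at h
  exact ZMod.val_injective n (by omega)

lemma alternatingLabel_two_mul {n q r t k : ℕ} (hr : r < q) (ht : t < k)
    (hqk : q * k ≤ (n + 1) / 2) :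
    2 * (r + q * t) < n ∧
      alternatingLabel n q ((2 * (r + q * t) : ℕ) : ZMod n) = n / 2 + r := by
  have h1 : r + q * t < q * k := by
    calc r + q * t < q * (t + 1) := by rw [mul_add]; omega
      _ ≤ q * k := Nat.mul_le_mul_left q ht
  have h2 : 2 * (r + q * t) < n := by omega
  refine ⟨h2, ?_⟩
  have h3 : ¬ (2 * (r + q * t)) % 2 = 1 := by omega
  rw [alternatingLabel, ZMod.val_cast_of_lt h2, if_neg h3, Nat.mul_div_cancel_left _ two_pos,
    Nat.add_mul_mod_self_left, Nat.mod_eq_of_lt hr]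

lemma exists_isDirLabeledPacking {n k : ℕ} (hk : 1 ≤ k) (hn : 2 * k ≤ n) :
    ∃ f σ, IsDirLabeledPacking n k (n / 2 + (n + 1) / 2 / k) f σ := by
  have hn2 : 2 ≤ n := by omega
  have : NeZero n := ⟨by omega⟩
  have : Fact (1 < n) := ⟨hn2⟩
  set q := (n + 1) / 2 / k with hq
  have hq0 : 0 < q := Nat.div_pos (by omega) hk
  have hqk : q * k ≤ (n + 1) / 2 := Nat.div_mul_le_self _ _
  have hlt (v : ZMod n) : alternatingLabel n q v < n / 2 + q := by
    have := ZMod.val_lt v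
    have := Nat.mod_lt (v.val / 2) hq0
    unfold alternatingLabel
    split_ifs <;> omega
  obtain ⟨τ, hτ, hinj⟩ := exists_fiberwise_perm_family (alternatingLabel n q) k
  have heven (v : ZMod n) (hv : v.val % 2 ≠ 1) : Function.Injective fun i => τ i v := by
    apply hinj
    have hr := Nat.mod_lt (v.val / 2) hq0
    have hlab : alternatingLabel n q v = n / 2 + v.val / 2 % q := if_neg hv
    have hmem (t : Fin k) := alternatingLabel_two_mul hr t.2 hqk
    let e : Fin k → {x // alternatingLabel n q x = alternatingLabel n q v} :=
      fun t => ⟨((2 * (v.val / 2 % q + q * t) : ℕ) : ZMod n), (hmem t).2.trans hlab.symm⟩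
    have he : Function.Injective e := by
      intro s t hst
      have h1 := congrArg (fun x => x.1.val) hst
      simp only [e, ZMod.val_cast_of_lt (hmem s).1, ZMod.val_cast_of_lt (hmem t).1] at h1
      have h2 : q * (s : ℕ) = q * t := by omega
      exact Fin.ext (Nat.eq_of_mul_eq_mul_left hq0 h2)
    simpa using Fintype.card_le_of_injective e he
  refine ⟨fun v => ⟨alternatingLabel n q v, hlt v⟩, τ, ?_, ⟨?_, ?_⟩, ?_⟩
  · rintro ⟨l, hl⟩
    by_cases h : l < n / 2
    · have h1 : 2 * l + 1 < n := by omega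
      refine ⟨((2 * l + 1 : ℕ) : ZMod n), Fin.ext ?_⟩
      change alternatingLabel n q _ = l
      rw [alternatingLabel, ZMod.val_cast_of_lt h1, if_pos (by omega)]
      omega
    · refine ⟨_, Fin.ext ((alternatingLabel_two_mul (r := l - n / 2) (t := 0)
        (by omega) hk hqk).2.trans ?_)⟩
      change n / 2 + (l - n / 2) = l
      omega
  · rintro i _ ⟨v, rfl⟩ h
    simp at h
  · intro i j hij
    rw [Set.disjoint_left]
    rintro _ ⟨_, ⟨u, rfl⟩, rfl⟩ ⟨_, ⟨v, rfl⟩, h⟩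
    simp only [Prod.mk.injEq] at h
    have hl1 : alternatingLabel n q u = alternatingLabel n q v := by
      rw [← hτ i u, ← h.1, hτ]
    have hl2 : alternatingLabel n q (u + 1) = alternatingLabel n q (v + 1) := by
      rw [← hτ i (u + 1), ← h.2, hτ]
    have hu := ZMod.val_add_one_eq_ite hn2 u
    have hv := ZMod.val_add_one_eq_ite hn2 v
    have huv : u = v := by
      by_cases h1 : u.val % 2 = 1
      · exact eq_of_alternatingLabel_eq h1 hl1
      by_cases h2 : (u + 1).val % 2 = 1
      · exact add_right_cancel (eq_of_alternatingLabel_eq h2 hl2)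
      have h3 : ¬ v.val % 2 = 1 := by
        rwa [← alternatingLabel_lt_half_iff q, ← hl1, alternatingLabel_lt_half_iff]
      have h4 : ¬ (v + 1).val % 2 = 1 := by
        rwa [← alternatingLabel_lt_half_iff q, ← hl2, alternatingLabel_lt_half_iff]
      apply ZMod.val_injective n
      split_ifs at hu hv <;> omega
    subst huv
    by_cases h1 : u.val % 2 = 1
    · have h2 : (u + 1).val % 2 ≠ 1 := by
        split_ifs at hu <;> omega
      exact hij (heven _ h2 h.2.symm)
    · exact hij (heven _ h1 h.1.symm)
  · intro i j v
    simp [hτ]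

/-- For every circuit `C⃗_n` of order `n = 2km + x`, with `k, m ≥ 1`,
`0 ≤ x < 2k`, and `(x, n) ∉ {(1,4), (1,6)}`, we have
`λ^k(C⃗_n) = ⌊n/2⌋ + ⌊⌈n/2⌉/k⌋`. -/
theorem dirLabeledPackingNumber_eq (k m x : ℕ) (hk : 1 ≤ k) (hm : 1 ≤ m)
    (hx : x < 2 * k)
    (h4 : ¬(x = 1 ∧ 2 * k * m + x = 4)) (h6 : ¬(x = 1 ∧ 2 * k * m + x = 6)) :
    dirLabeledPackingNumber (2 * k * m + x) k =
      (2 * k * m + x) / 2 + ((2 * k * m + x + 1) / 2) / k := by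
  have hkm : 2 * k ≤ 2 * k * m + x :=
    (Nat.le_mul_of_pos_right _ hm).trans (Nat.le_add_right _ _)
  have : NeZero (2 * k * m + x) := ⟨by omega⟩
  refine IsGreatest.csSup_eq ⟨exists_isDirLabeledPacking hk hkm, ?_⟩
  rintro p ⟨f, σ, h⟩
  exact h.card_le hk
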